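/- arXiv:1201.5487 — 2 statements merged into one kernel-verified Lean document; each statement's English description precedes it below -/
import Mathlib

section
/- Let T be a K-linear triangulated category and let X be a full subcategory of T that is closed under the shifts [1] and [-1] and satisfies thick(X) = T (the smallest thick subcategory of T containing X is all of T). If X is Hom-finite (all morphism spaces of X are finite dimensional over K), then T is Hom-finite. -/
/-!
STATEMENT 0: Let `T` be a `K`-linear triangulated category and `X` a full subcategory
(encoded by its set `S` of objects) closed under the shifts `[1]` and `[-1]` with
`thick(X) = T`.  If `X` is Hom-finite then `T` is Hom-finite.
-/

open CategoryTheory CategoryTheory.Limits CategoryTheory.Pretriangulated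

/-- A set of objects of a (pre)triangulated category is *thick* if it contains the zero
objects and is closed under isomorphisms, shifts, extensions (cones of distinguished
triangles) and direct summands. -/
def IsThickSubcat {C : Type*} [Category C] [HasZeroObject C] [Preadditive C]
    [HasShift C ℤ] [∀ n : ℤ, (shiftFunctor C n).Additive] [Pretriangulated C]
    (P : Set C) : Prop :=
  (∀ Z : C, IsZero Z → Z ∈ P) ∧
  (∀ ⦃X Y : C⦄, (X ≅ Y) → X ∈ P → Y ∈ P) ∧
  (∀ (X : C) (n : ℤ), X ∈ P → X⟦n⟧ ∈ P) ∧
  (∀ T : Triangle C, (T ∈ distTriang C) → T.obj₁ ∈ P → T.obj₂ ∈ P → T.obj₃ ∈ P) ∧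
  (∀ ⦃X Y : C⦄ (r : X ⟶ Y) (s : Y ⟶ X), s ≫ r = 𝟙 Y → X ∈ P → Y ∈ P)

section HomFinite

variable {K : Type*} [Field K] {C : Type*} [Category C] [Preadditive C]
  [CategoryTheory.Linear K C]

/-- Finite dimensionality of morphism spaces passes to retracts of the target. -/
lemma finiteDimensional_hom_of_retract_right (A : C) {X Y : C} (r : X ⟶ Y) (s : Y ⟶ X)
    (h : s ≫ r = 𝟙 Y) [FiniteDimensional K (A ⟶ X)] : FiniteDimensional K (A ⟶ Y) :=
  Module.Finite.of_surjective (Linear.rightComp K A r) fun f => ⟨f ≫ s, by simp [h]⟩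

/-- Finite dimensionality of morphism spaces passes to retracts of the source. -/
lemma finiteDimensional_hom_of_retract_left (A : C) {X Y : C} (r : X ⟶ Y) (s : Y ⟶ X)
    (h : s ≫ r = 𝟙 Y) [FiniteDimensional K (X ⟶ A)] : FiniteDimensional K (Y ⟶ A) :=
  Module.Finite.of_surjective (Linear.leftComp K A s) fun f => ⟨r ≫ f, by simp [reassoc_of% h]⟩

lemma finiteDimensional_hom_of_isZero_right (A : C) {Z : C} (hZ : IsZero Z) :
    FiniteDimensional K (A ⟶ Z) :=
  haveI : Subsingleton (A ⟶ Z) := ⟨hZ.eq_of_tgt⟩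
  inferInstance

lemma finiteDimensional_hom_of_isZero_left (A : C) {Z : C} (hZ : IsZero Z) :
    FiniteDimensional K (Z ⟶ A) :=
  haveI : Subsingleton (Z ⟶ A) := ⟨hZ.eq_of_src⟩
  inferInstance

variable [HasZeroObject C] [HasShift C ℤ] [∀ n : ℤ, (shiftFunctor C n).Additive]
  [Pretriangulated C]

lemma finiteDimensional_hom_obj₃_right (A : C) {T : Triangle C} (hT : T ∈ distTriang C)
    [FiniteDimensional K (A ⟶ T.obj₂)] [FiniteDimensional K (A ⟶ T.obj₁⟦(1 : ℤ)⟧)] :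
    FiniteDimensional K (A ⟶ T.obj₃) := by
  have : IsNoetherian K (A ⟶ T.obj₃) := by
    refine isNoetherian_of_range_eq_ker (Linear.rightComp K A T.mor₂)
      (Linear.rightComp K A T.mor₃) (le_antisymm ?_ fun f hf => ?_)
    · rintro _ ⟨g, rfl⟩
      simp [comp_distTriang_mor_zero₂₃ T hT]
    · obtain ⟨g, hg⟩ := T.coyoneda_exact₃ hT f hf
      exact ⟨g, hg.symm⟩
  infer_instance

lemma finiteDimensional_hom_obj₃_left (A : C) {T : Triangle C} (hT : T ∈ distTriang C)
    [FiniteDimensional K (T.obj₂ ⟶ A)] [FiniteDimensional K (T.obj₁⟦(1 : ℤ)⟧ ⟶ A)] :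
    FiniteDimensional K (T.obj₃ ⟶ A) := by
  have : IsNoetherian K (T.obj₃ ⟶ A) := by
    refine isNoetherian_of_range_eq_ker (Linear.leftComp K A T.mor₃)
      (Linear.leftComp K A T.mor₂) (le_antisymm ?_ fun f hf => ?_)
    · rintro _ ⟨g, rfl⟩
      simp [reassoc_of% comp_distTriang_mor_zero₂₃ T hT]
    · obtain ⟨g, hg⟩ := T.yoneda_exact₃ hT f hf
      exact ⟨g, hg.symm⟩
  infer_instance

variable (K) in
/-- The objects all of whose shifts receive only finite dimensional spaces of morphisms from
objects of `S` form a thick subcategory. -/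
lemma isThickSubcat_finiteDimensional_hom_right (S : Set C) :
    IsThickSubcat {Y : C | ∀ A ∈ S, ∀ n : ℤ, FiniteDimensional K (A ⟶ Y⟦n⟧)} := by
  have retract : ∀ ⦃X Y : C⦄ (r : X ⟶ Y) (s : Y ⟶ X), s ≫ r = 𝟙 Y →
      ∀ A : C, ∀ n : ℤ, FiniteDimensional K (A ⟶ X⟦n⟧) → FiniteDimensional K (A ⟶ Y⟦n⟧) :=
    fun X Y r s h A n _ => finiteDimensional_hom_of_retract_right A
      ((shiftFunctor C n).map r) ((shiftFunctor C n).map s)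
      (by rw [← Functor.map_comp, h, CategoryTheory.Functor.map_id])
  refine ⟨fun Z hZ A _ n => ?_, fun X Y e hX A hA n => ?_, fun X m hX A hA n => ?_,
    fun T hT h₁ h₂ A hA n => ?_, fun X Y r s h hX A hA n => retract r s h A n (hX A hA n)⟩
  · exact finiteDimensional_hom_of_isZero_right A ((shiftFunctor C n).map_isZero hZ)
  · exact retract e.hom e.inv e.inv_hom_id A n (hX A hA n)
  · have := hX A hA (m + n)
    let e := (shiftFunctorAdd C m n).app X
    exact finiteDimensional_hom_of_retract_right A e.hom e.inv e.inv_hom_id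
  · have := h₁ A hA (n + 1)
    let e := (shiftFunctorAdd C n 1).app T.obj₁
    have hshift : (Triangle.shiftFunctor C n).obj T ∈ distTriang C :=
      Triangle.shift_distinguished T hT n
    have : FiniteDimensional K (A ⟶ ((Triangle.shiftFunctor C n).obj T).obj₁⟦(1 : ℤ)⟧) :=
      finiteDimensional_hom_of_retract_right A e.hom e.inv e.inv_hom_id
    have : FiniteDimensional K (A ⟶ ((Triangle.shiftFunctor C n).obj T).obj₂) := h₂ A hA n
    exact finiteDimensional_hom_obj₃_right A hshift

variable (K C) in
/-- The objects all of whose shifts have only finite dimensional spaces of morphisms to any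
object form a thick subcategory. -/
lemma isThickSubcat_finiteDimensional_hom_left :
    IsThickSubcat {X : C | ∀ A : C, ∀ n : ℤ, FiniteDimensional K (X⟦n⟧ ⟶ A)} := by
  have retract : ∀ ⦃X Y : C⦄ (r : X ⟶ Y) (s : Y ⟶ X), s ≫ r = 𝟙 Y →
      ∀ A : C, ∀ n : ℤ, FiniteDimensional K (X⟦n⟧ ⟶ A) → FiniteDimensional K (Y⟦n⟧ ⟶ A) :=
    fun X Y r s h A n _ => finiteDimensional_hom_of_retract_left A
      ((shiftFunctor C n).map r) ((shiftFunctor C n).map s)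
      (by rw [← Functor.map_comp, h, CategoryTheory.Functor.map_id])
  refine ⟨fun Z hZ A n => ?_, fun X Y e hX A n => ?_, fun X m hX A n => ?_,
    fun T hT h₁ h₂ A n => ?_, fun X Y r s h hX A n => retract r s h A n (hX A n)⟩
  · exact finiteDimensional_hom_of_isZero_left A ((shiftFunctor C n).map_isZero hZ)
  · exact retract e.hom e.inv e.inv_hom_id A n (hX A n)
  · have := hX A (m + n)
    let e := (shiftFunctorAdd C m n).app X
    exact finiteDimensional_hom_of_retract_left A e.hom e.inv e.inv_hom_id
  · have := h₁ A (n + 1)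
    let e := (shiftFunctorAdd C n 1).app T.obj₁
    have hshift : (Triangle.shiftFunctor C n).obj T ∈ distTriang C :=
      Triangle.shift_distinguished T hT n
    have : FiniteDimensional K (((Triangle.shiftFunctor C n).obj T).obj₁⟦(1 : ℤ)⟧ ⟶ A) :=
      finiteDimensional_hom_of_retract_left A e.hom e.inv e.inv_hom_id
    have : FiniteDimensional K (((Triangle.shiftFunctor C n).obj T).obj₂ ⟶ A) := h₂ A n
    exact finiteDimensional_hom_obj₃_left A hshift

end HomFinite

/-- A set of objects closed under `⟦1⟧` and `⟦-1⟧` is closed under all shifts, up to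
isomorphism. -/
lemma exists_mem_shift_iso {C : Type*} [Category C] [HasShift C ℤ] {S : Set C}
    (hS1 : ∀ X ∈ S, X⟦(1 : ℤ)⟧ ∈ S) (hSm1 : ∀ X ∈ S, X⟦(-1 : ℤ)⟧ ∈ S)
    {X : C} (hX : X ∈ S) (n : ℤ) : ∃ Z ∈ S, Nonempty (X⟦n⟧ ≅ Z) := by
  induction n using Int.induction_on with
  | zero => exact ⟨X, hX, ⟨(shiftFunctorZero C ℤ).app X⟩⟩
  | succ n ih =>
    obtain ⟨Z, hZ, ⟨e⟩⟩ := ih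
    exact ⟨_, hS1 Z hZ, ⟨(shiftFunctorAdd C (n : ℤ) 1).app X ≪≫ (shiftFunctor C 1).mapIso e⟩⟩
  | pred n ih =>
    obtain ⟨Z, hZ, ⟨e⟩⟩ := ih
    exact ⟨_, hSm1 Z hZ,
      ⟨(shiftFunctorAdd C (-n : ℤ) (-1)).app X ≪≫ (shiftFunctor C (-1)).mapIso e⟩⟩

/-- If a `K`-linear triangulated category `C` is generated, as a triangulated category, by a
full subcategory `S` which is closed under the shifts `[1]` and `[-1]` and whose morphism
spaces are finite dimensional over `K`, then all morphism spaces of `C` are finite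
dimensional over `K`. -/
theorem stmt_0 (K : Type) [Field K] (C : Type) [Category C] [Preadditive C]
    [CategoryTheory.Linear K C] [HasZeroObject C] [HasShift C ℤ]
    [∀ n : ℤ, (shiftFunctor C n).Additive] [Pretriangulated C]
    (S : Set C)
    (hS1 : ∀ X ∈ S, X⟦(1 : ℤ)⟧ ∈ S)
    (hSm1 : ∀ X ∈ S, X⟦(-1 : ℤ)⟧ ∈ S)
    (hgen : ∀ P : Set C, IsThickSubcat P → S ⊆ P → ∀ Y : C, Y ∈ P)
    (hfin : ∀ X ∈ S, ∀ Y ∈ S, FiniteDimensional K (X ⟶ Y)) :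
    ∀ X Y : C, FiniteDimensional K (X ⟶ Y) := by
  have hright : ∀ A ∈ S, ∀ Y : C, FiniteDimensional K (A ⟶ Y) := fun A hA Y => by
    have := hgen _ (isThickSubcat_finiteDimensional_hom_right K S) (fun B hB A hA n => by
      obtain ⟨Z, hZ, ⟨e⟩⟩ := exists_mem_shift_iso hS1 hSm1 hB n
      have := hfin A hA Z hZ
      exact finiteDimensional_hom_of_retract_right A e.inv e.hom e.hom_inv_id) Y A hA 0
    let e := (shiftFunctorZero C ℤ).app Y
    exact finiteDimensional_hom_of_retract_right A e.hom e.inv e.inv_hom_id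
  intro X Y
  have := hgen _ (isThickSubcat_finiteDimensional_hom_left K C) (fun B hB A n => by
    obtain ⟨Z, hZ, ⟨e⟩⟩ := exists_mem_shift_iso hS1 hSm1 hB n
    have := hright Z hZ A
    exact finiteDimensional_hom_of_retract_left A e.inv e.hom e.hom_inv_id) X Y 0
  let e := (shiftFunctorZero C ℤ).app X
  exact finiteDimensional_hom_of_retract_left Y e.hom e.inv e.inv_hom_id
end

section
/- Let T and U be triangulated categories, X a full subcategory of T closed under the shifts [1] and [-1], and F : T → U a triangle-functor. Then: (1) if thick(X) = T and the restriction of F to X is fully faithful, then F is fully faithful; (2) if T is Krull-Schmidt, thick(Im F) = U, and F is full, then F is essentially surjective (dense). -/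
/-!
STATEMENT 1: Let `T`, `U` be triangulated categories, `X` a full subcategory of `T`
(encoded by its set `S` of objects) closed under `[1]` and `[-1]`, and `F : T ⥤ U` a
triangle functor.  Then:
(1) if `thick(X) = T` and the restriction of `F` to `X` is fully faithful, then `F` is
    fully faithful;
(2) if `T` is Krull–Schmidt, `thick(Im F) = U` and `F` is full, then `F` is dense
    (essentially surjective).
-/

open CategoryTheory CategoryTheory.Limits CategoryTheory.Pretriangulated

/-- An additive category is Krull–Schmidt if every object is a finite biproduct of
objects having local endomorphism rings. -/
def IsKrullSchmidt (C : Type*) [Category C] [Preadditive C] [HasFiniteBiproducts C] : Prop :=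
  ∀ X : C, ∃ (n : ℕ) (f : Fin n → C),
    Nonempty (X ≅ ⨁ f) ∧ ∀ i, IsLocalRing (End (f i))

namespace CategoryTheory

namespace Functor

section

variable {C D : Type*} [Category C] [Category D]

/-- Bijectivity of `F` on a hom set passes to retracts in both variables. -/
lemma map_bijective_of_retract (F : C ⥤ D) {X X' Y Y' : C} (hX : Retract X' X)
    (hY : Retract Y' Y) (h : Function.Bijective (fun φ : X ⟶ Y => F.map φ)) :
    Function.Bijective (fun φ : X' ⟶ Y' => F.map φ) := by
  constructor
  · intro f g hfg
    have hfg' : F.map f = F.map g := hfg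
    have key : hX.r ≫ f ≫ hY.i = hX.r ≫ g ≫ hY.i :=
      h.1 (by simp only [F.map_comp, hfg'])
    simpa using congrArg (fun t => hX.i ≫ t ≫ hY.r) key
  · intro φ
    obtain ⟨k, hk⟩ := h.2 (F.map hX.r ≫ φ ≫ F.map hY.i)
    have hk' : F.map k = F.map hX.r ≫ φ ≫ F.map hY.i := hk
    refine ⟨hX.i ≫ k ≫ hY.r, ?_⟩
    have e₁ := (hX.map F).retract
    have e₂ := (hY.map F).retract
    rw [Retract.map_i, Retract.map_r] at e₁ e₂
    simp only [F.map_comp, hk', Category.assoc, e₂, Category.comp_id]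
    rw [← Category.assoc, e₁, Category.id_comp]

end

section

variable {C D : Type*} [Category C] [Category D]
  [HasZeroObject C] [HasZeroObject D] [Preadditive C] [Preadditive D]
  [HasShift C ℤ] [HasShift D ℤ]
  [∀ n : ℤ, (shiftFunctor C n).Additive] [∀ n : ℤ, (shiftFunctor D n).Additive]
  [Pretriangulated C] [Pretriangulated D]
  (F : C ⥤ D) [F.CommShift ℤ] [F.IsTriangulated]

lemma coyoneda_exact₂_map {T : Triangle C} (hT : T ∈ distTriang C) {W : D}
    (f : W ⟶ F.obj T.obj₂) (hf : f ≫ F.map T.mor₂ = 0) :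
    ∃ g : W ⟶ F.obj T.obj₁, f = g ≫ F.map T.mor₁ :=
  Triangle.coyoneda_exact₂ _ (F.map_distinguished T hT) f hf

lemma yoneda_exact₂_map {T : Triangle C} (hT : T ∈ distTriang C) {W : D}
    (f : F.obj T.obj₂ ⟶ W) (hf : F.map T.mor₁ ≫ f = 0) :
    ∃ g : F.obj T.obj₃ ⟶ W, f = F.map T.mor₂ ≫ g :=
  Triangle.yoneda_exact₂ _ (F.map_distinguished T hT) f hf

lemma map_bijective_obj₃_right {T : Triangle C} (hT : T ∈ distTriang C) {X : C}
    (h₁ : Function.Bijective (fun φ : X ⟶ T.obj₁ => F.map φ))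
    (h₂ : Function.Bijective (fun φ : X ⟶ T.obj₂ => F.map φ))
    (h₁' : Function.Bijective (fun φ : X ⟶ T.obj₁⟦(1 : ℤ)⟧ => F.map φ))
    (h₂' : Function.Bijective (fun φ : X ⟶ T.obj₂⟦(1 : ℤ)⟧ => F.map φ)) :
    Function.Bijective (fun φ : X ⟶ T.obj₃ => F.map φ) := by
  have hrot := rot_of_distTriang T hT
  constructor
  · suffices ∀ f : X ⟶ T.obj₃, F.map f = 0 → f = 0 by
      intro f g hfg
      exact sub_eq_zero.1 (this _ (by rw [F.map_sub]; exact sub_eq_zero.2 hfg))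
    intro f hf
    obtain ⟨g, rfl⟩ := Triangle.coyoneda_exact₃ T hT f
      (h₁'.1 (by simp [hf]))
    obtain ⟨u, hu⟩ := F.coyoneda_exact₂_map hT (F.map g) (by rw [← F.map_comp, hf])
    obtain ⟨k, rfl⟩ := h₁.2 u
    obtain rfl : g = k ≫ T.mor₁ := h₂.1 (by simpa using hu)
    rw [Category.assoc, comp_distTriang_mor_zero₁₂ T hT, comp_zero]
  · intro φ
    obtain ⟨k, hk⟩ := h₁'.2 (φ ≫ F.map T.mor₃)
    have hk' : F.map k = φ ≫ F.map T.mor₃ := hk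
    obtain ⟨g, rfl⟩ := Triangle.coyoneda_exact₁ T hT k (h₂'.1 (by
      dsimp only
      rw [F.map_comp, hk', Category.assoc, ← F.map_comp,
        comp_distTriang_mor_zero₃₁ T hT, F.map_zero, comp_zero, F.map_zero]))
    obtain ⟨u, hu⟩ := F.coyoneda_exact₂_map hrot (φ - F.map g) (by
      change (φ - F.map g) ≫ F.map T.mor₃ = 0
      rw [Preadditive.sub_comp, ← hk', F.map_comp, sub_self])
    obtain ⟨l, rfl⟩ := h₂.2 u
    refine ⟨g + l ≫ T.mor₂, ?_⟩
    have hu' : φ - F.map g = F.map l ≫ F.map T.mor₂ := hu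
    dsimp only
    rw [F.map_add, F.map_comp, ← hu', add_sub_cancel]

lemma map_bijective_obj₃_left {T : Triangle C} (hT : T ∈ distTriang C) {Y : C}
    (h₁ : Function.Bijective (fun φ : T.obj₁ ⟶ Y => F.map φ))
    (h₂ : Function.Bijective (fun φ : T.obj₂ ⟶ Y => F.map φ))
    (h₁' : Function.Bijective (fun φ : T.obj₁⟦(1 : ℤ)⟧ ⟶ Y => F.map φ))
    (h₂' : Function.Bijective (fun φ : T.obj₂⟦(1 : ℤ)⟧ ⟶ Y => F.map φ)) :
    Function.Bijective (fun φ : T.obj₃ ⟶ Y => F.map φ) := by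
  have hrot := rot_of_distTriang T hT
  have hrot₂ := rot_of_distTriang _ hrot
  constructor
  · suffices ∀ f : T.obj₃ ⟶ Y, F.map f = 0 → f = 0 by
      intro f g hfg
      exact sub_eq_zero.1 (this _ (by rw [F.map_sub]; exact sub_eq_zero.2 hfg))
    intro f hf
    obtain ⟨g, rfl⟩ := Triangle.yoneda_exact₃ T hT f
      (h₂.1 (by simp [hf]))
    obtain ⟨u, hu⟩ := F.yoneda_exact₂_map hrot₂ (F.map g)
      ((F.map_comp T.mor₃ g).symm.trans hf)
    obtain ⟨k, rfl⟩ := h₂'.2 u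
    have hu' : F.map g = F.map (-T.mor₁⟦(1 : ℤ)⟧') ≫ F.map k := hu
    obtain rfl : g = (-T.mor₁⟦(1 : ℤ)⟧') ≫ k := h₁'.1 (by
      dsimp only; rw [hu', F.map_comp])
    rw [Preadditive.neg_comp, Preadditive.comp_neg, ← Category.assoc,
      comp_distTriang_mor_zero₃₁ T hT, zero_comp, neg_zero]
  · intro φ
    obtain ⟨k, hk⟩ := h₂.2 (F.map T.mor₂ ≫ φ)
    have hk' : F.map k = F.map T.mor₂ ≫ φ := hk
    obtain ⟨g, rfl⟩ := Triangle.yoneda_exact₂ T hT k (h₁.1 (by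
      dsimp only
      rw [F.map_comp, hk', ← Category.assoc, ← F.map_comp,
        comp_distTriang_mor_zero₁₂ T hT, F.map_zero, zero_comp, F.map_zero]))
    obtain ⟨u, hu⟩ := F.yoneda_exact₂_map hrot (φ - F.map g) (by
      change F.map T.mor₂ ≫ (φ - F.map g) = 0
      rw [Preadditive.comp_sub, ← hk', F.map_comp, sub_self])
    obtain ⟨l, rfl⟩ := h₁'.2 u
    refine ⟨g + T.mor₃ ≫ l, ?_⟩
    have hu' : φ - F.map g = F.map T.mor₃ ≫ F.map l := hu
    dsimp only
    rw [F.map_add, F.map_comp, ← hu', add_sub_cancel]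

lemma isThickSubcat_map_bijective_right (X : C) :
    IsThickSubcat {Y : C | ∀ n : ℤ, Function.Bijective (fun φ : X ⟶ Y⟦n⟧ => F.map φ)} := by
  refine ⟨fun Z hZ n => ?_, fun Y Y' e hY n => ?_, fun Y m hY n => ?_,
    fun T hT h₁ h₂ n => ?_, fun Y Y' r s hrs hY n => ?_⟩
  · have hZ' := (shiftFunctor C n).map_isZero hZ
    exact ⟨fun _ _ _ => hZ'.eq_of_tgt _ _,
      fun _ => ⟨0, (F.map_isZero hZ').eq_of_tgt _ _⟩⟩
  · exact F.map_bijective_of_retract (.refl X)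
      ((Retract.ofIso e.symm).map (shiftFunctor C n)) (hY n)
  · exact F.map_bijective_of_retract (.refl X)
      (Retract.ofIso ((shiftFunctorAdd C m n).app Y).symm) (hY (m + n))
  · have shift : ∀ Y : C, (∀ n : ℤ, Function.Bijective (fun φ : X ⟶ Y⟦n⟧ => F.map φ)) →
        Function.Bijective (fun φ : X ⟶ Y⟦n⟧⟦(1 : ℤ)⟧ => F.map φ) := fun Y hY =>
      F.map_bijective_of_retract (.refl X)
        (Retract.ofIso ((shiftFunctorAdd C n 1).app Y).symm) (hY (n + 1))
    exact F.map_bijective_obj₃_right (Triangle.shift_distinguished T hT n)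
      (h₁ n) (h₂ n) (shift _ h₁) (shift _ h₂)
  · exact F.map_bijective_of_retract (.refl X)
      ((Retract.mk s r hrs).map (shiftFunctor C n)) (hY n)

lemma isThickSubcat_map_bijective_left (Y : C) :
    IsThickSubcat {X : C | ∀ n : ℤ, Function.Bijective (fun φ : X⟦n⟧ ⟶ Y => F.map φ)} := by
  refine ⟨fun Z hZ n => ?_, fun X X' e hX n => ?_, fun X m hX n => ?_,
    fun T hT h₁ h₂ n => ?_, fun X X' r s hrs hX n => ?_⟩
  · have hZ' := (shiftFunctor C n).map_isZero hZ
    exact ⟨fun _ _ _ => hZ'.eq_of_src _ _,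
      fun _ => ⟨0, (F.map_isZero hZ').eq_of_src _ _⟩⟩
  · exact F.map_bijective_of_retract
      ((Retract.ofIso e.symm).map (shiftFunctor C n)) (.refl Y) (hX n)
  · exact F.map_bijective_of_retract
      (Retract.ofIso ((shiftFunctorAdd C m n).app X).symm) (.refl Y) (hX (m + n))
  · have shift : ∀ X : C, (∀ n : ℤ, Function.Bijective (fun φ : X⟦n⟧ ⟶ Y => F.map φ)) →
        Function.Bijective (fun φ : X⟦n⟧⟦(1 : ℤ)⟧ ⟶ Y => F.map φ) := fun X hX =>
      F.map_bijective_of_retract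
        (Retract.ofIso ((shiftFunctorAdd C n 1).app X).symm) (.refl Y) (hX (n + 1))
    exact F.map_bijective_obj₃_left (Triangle.shift_distinguished T hT n)
      (h₁ n) (h₂ n) (shift _ h₁) (shift _ h₂)
  · exact F.map_bijective_of_retract
      ((Retract.mk s r hrs).map (shiftFunctor C n)) (.refl Y) (hX n)

end

end Functor

/-- A class of objects closed under `⟦1⟧` and `⟦-1⟧` is closed under all shifts up to
isomorphism. -/
lemma exists_shift_iso_of_shift_one {C : Type*} [Category C] [HasShift C ℤ] {S : Set C}
    (hS1 : ∀ X ∈ S, X⟦(1 : ℤ)⟧ ∈ S) (hSm1 : ∀ X ∈ S, X⟦(-1 : ℤ)⟧ ∈ S)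
    {X : C} (hX : X ∈ S) (n : ℤ) : ∃ X' ∈ S, Nonempty (X⟦n⟧ ≅ X') := by
  induction n using Int.induction_on with
  | zero => exact ⟨X, hX, ⟨(shiftFunctorZero C ℤ).app X⟩⟩
  | succ i ih =>
    obtain ⟨X', hX', ⟨e⟩⟩ := ih
    exact ⟨_, hS1 _ hX', ⟨(shiftFunctorAdd C (i : ℤ) 1).app X ≪≫
      (shiftFunctor C (1 : ℤ)).mapIso e⟩⟩
  | pred i ih =>
    obtain ⟨X', hX', ⟨e⟩⟩ := ih
    exact ⟨_, hSm1 _ hX', ⟨(shiftFunctorAdd C (-(i : ℤ)) (-1)).app X ≪≫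
      (shiftFunctor C (-1 : ℤ)).mapIso e⟩⟩

section

variable {D : Type*} [Category D] [Preadditive D]

lemma isIso_one_sub_comp_of_swap {A Y : D} (r : A ⟶ Y) (s : Y ⟶ A)
    (h : IsIso (𝟙 A - r ≫ s)) : IsIso (𝟙 Y - s ≫ r) := by
  set u := inv (𝟙 A - r ≫ s)
  have h₁ : (𝟙 A - r ≫ s) ≫ u = 𝟙 A := IsIso.hom_inv_id _
  have h₂ : u ≫ (𝟙 A - r ≫ s) = 𝟙 A := IsIso.inv_hom_id _
  have h₁' : r ≫ s ≫ u = u - 𝟙 A := by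
    rw [Preadditive.sub_comp, Category.id_comp, Category.assoc] at h₁
    rw [← h₁]; abel
  have h₂' : u ≫ r ≫ s = u - 𝟙 A := by
    rw [Preadditive.comp_sub, Category.comp_id] at h₂
    rw [← h₂]; abel
  refine ⟨𝟙 Y + s ≫ u ≫ r, ?_, ?_⟩
  · have : s ≫ r ≫ s ≫ u ≫ r = s ≫ (u - 𝟙 A) ≫ r := by
      rw [← h₁']; simp only [Category.assoc]
    simp only [Preadditive.sub_comp, Preadditive.comp_add, Category.id_comp,
      Category.comp_id, Category.assoc, this, Preadditive.comp_sub]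
    abel
  · have : s ≫ u ≫ r ≫ s ≫ r = s ≫ (u - 𝟙 A) ≫ r := by
      rw [← h₂']; simp only [Category.assoc]
    simp only [Preadditive.add_comp, Preadditive.comp_sub, Category.id_comp,
      Category.comp_id, Category.assoc, this, Preadditive.sub_comp]
    abel

variable [HasZeroObject D] [HasShift D ℤ] [∀ n : ℤ, (shiftFunctor D n).Additive]
  [Pretriangulated D]

/-- In a pretriangulated category, a retract has a complement. -/
lemma exists_iso_biprod_of_comp_eq_id [HasBinaryBiproducts D] {A Y : D} (i : A ⟶ Y)
    (p : Y ⟶ A) (h : i ≫ p = 𝟙 A) :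
    ∃ (Y₁ : D) (e : Y ≅ Y₁ ⊞ A), p = e.hom ≫ biprod.snd := by
  obtain ⟨Z, f, g, hT⟩ := distinguished_cocone_triangle₁ p
  have hp : Epi p := (SplitEpi.mk i h).epi
  obtain ⟨e, -, he⟩ := exists_iso_binaryBiproduct_of_distTriang _ hT
    (Triangle.mor₃_eq_zero_of_epi₂ _ hT hp)
  exact ⟨Z, e, he⟩

/-- A Krull-Schmidt type argument: let `A i` be objects of `D` such that `a` or `1 - a` is
invertible for every endomorphism `a` of `A i`. A class of objects that is closed under
isomorphisms and finite biproducts and contains the `A i` contains every retract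
of a finite sum of objects `A i`. -/
lemma mem_of_sum_comp_eq_id [HasBinaryBiproducts D] (P : ObjectProperty D)
    [P.IsClosedUnderIsomorphisms] (hzero : ∀ Z, IsZero Z → P Z)
    (hbiprod : ∀ X Y, P X → P Y → P (X ⊞ Y)) {ι : Type*} (A : ι → D) (hA : ∀ i, P (A i))
    (hloc : ∀ i (a : A i ⟶ A i), IsIso a ∨ IsIso (𝟙 (A i) - a)) (t : Finset ι) (Y : D)
    (s : ∀ i, Y ⟶ A i) (r : ∀ i, A i ⟶ Y) (h : ∑ i ∈ t, s i ≫ r i = 𝟙 Y) : P Y := by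
  classical
  induction t using Finset.induction_on generalizing Y with
  | empty => exact hzero _ ((IsZero.iff_id_eq_zero Y).2 (by simpa using h.symm))
  | insert a t ha ih =>
    rw [Finset.sum_insert ha] at h
    have ht : ∑ i ∈ t, s i ≫ r i = 𝟙 Y - s a ≫ r a := by rw [← h]; abel
    obtain hu | hu := hloc a (r a ≫ s a)
    · obtain ⟨Y₁, e, he⟩ := exists_iso_biprod_of_comp_eq_id (inv (r a ≫ s a) ≫ r a) (s a)
        (by simp)
      refine P.prop_of_iso e.symm (hbiprod _ _ ?_ (hA a))
      refine ih Y₁ (fun i => (biprod.inl ≫ e.inv) ≫ s i)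
        (fun i => r i ≫ e.hom ≫ biprod.fst) ?_
      have hs : (biprod.inl ≫ e.inv) ≫ s a = 0 := by simp [he]
      calc _ = (biprod.inl ≫ e.inv) ≫ (∑ i ∈ t, s i ≫ r i) ≫ e.hom ≫ biprod.fst := by
            simp only [Preadditive.comp_sum, Preadditive.sum_comp, Category.assoc]
        _ = _ := by
            rw [ht, Preadditive.sub_comp, Preadditive.comp_sub, Category.assoc (s a),
              ← Category.assoc _ (s a), hs]
            simp
    · have := isIso_one_sub_comp_of_swap (r a) (s a) hu
      refine ih Y s (fun i => r i ≫ inv (𝟙 Y - s a ≫ r a)) ?_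
      simp only [← Category.assoc]
      rw [← Preadditive.sum_comp, ht, IsIso.hom_inv_id]

end

namespace Functor

lemma isIso_or_isIso_id_sub_of_isLocalRing {C D : Type*} [Category C] [Category D]
    [Preadditive C] [Preadditive D] (F : C ⥤ D) [F.Additive] [F.Full] (X : C)
    [IsLocalRing (End X)]
    (a : F.obj X ⟶ F.obj X) : IsIso a ∨ IsIso (𝟙 (F.obj X) - a) := by
  obtain ⟨b, rfl⟩ := F.map_surjective a
  let b' : End X := b
  obtain h | h := IsLocalRing.isUnit_or_isUnit_of_add_one (add_sub_cancel b' 1)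
  · have : IsIso b := (isUnit_iff_isIso b).1 h
    exact Or.inl inferInstance
  · have : IsIso (𝟙 X - b) := (isUnit_iff_isIso _).1 h
    rw [← F.map_id, ← F.map_sub]
    exact Or.inr inferInstance

variable {C D : Type*} [Category C] [Category D]
  [HasZeroObject C] [HasZeroObject D] [Preadditive C] [Preadditive D]
  [HasShift C ℤ] [HasShift D ℤ]
  [∀ n : ℤ, (shiftFunctor C n).Additive] [∀ n : ℤ, (shiftFunctor D n).Additive]
  [Pretriangulated C] [Pretriangulated D] [HasFiniteBiproducts C]
  (F : C ⥤ D) [F.CommShift ℤ] [F.IsTriangulated]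

/-- The essential image of a full triangulated functor from a Krull-Schmidt category is
closed under retracts. -/
lemma essImage_of_retract [F.Full] (hC : IsKrullSchmidt C) {X : C} {Y : D}
    (h : Retract Y (F.obj X)) : F.essImage Y := by
  obtain ⟨n, f, ⟨e⟩, hf⟩ := hC X
  have := preservesBinaryBiproducts_of_preservesBinaryProducts F
  refine mem_of_sum_comp_eq_id F.essImage
    (fun Z hZ => ⟨_, ⟨(F.map_isZero (isZero_zero C)).iso hZ⟩⟩) ?_
    (fun i => F.obj (f i)) (fun i => F.obj_mem_essImage _)
    (fun i => have := hf i; F.isIso_or_isIso_id_sub_of_isLocalRing (f i)) Finset.univ Y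
    (fun i => h.i ≫ F.map (e.hom ≫ biproduct.π f i))
    (fun i => F.map (biproduct.ι f i ≫ e.inv) ≫ h.r) ?_
  · rintro _ _ ⟨X₁, ⟨e₁⟩⟩ ⟨X₂, ⟨e₂⟩⟩
    exact ⟨X₁ ⊞ X₂, ⟨F.mapBiprod X₁ X₂ ≪≫ biprod.mapIso e₁ e₂⟩⟩
  · have hsum : ∑ i, (e.hom ≫ biproduct.π f i) ≫ biproduct.ι f i ≫ e.inv = 𝟙 X := by
      calc _ = e.hom ≫ (∑ i, biproduct.π f i ≫ biproduct.ι f i) ≫ e.inv := by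
            simp only [Preadditive.comp_sum, Preadditive.sum_comp, Category.assoc]
        _ = _ := by simp [biproduct.total]
    calc _ = h.i ≫ F.map (∑ i, (e.hom ≫ biproduct.π f i) ≫ biproduct.ι f i ≫ e.inv) ≫ h.r := by
          simp only [F.map_sum, F.map_comp, Preadditive.comp_sum, Preadditive.sum_comp,
            Category.assoc]
      _ = _ := by rw [hsum, F.map_id, Category.id_comp, h.retract]

lemma isThickSubcat_essImage [F.Full] (hC : IsKrullSchmidt C) :
    IsThickSubcat {Y : D | F.essImage Y} := by
  refine ⟨fun Z hZ => ?_, fun Y Y' e hY => ?_, fun Y n hY => ?_,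
    fun T hT h₁ h₂ => ?_, fun Y Y' r s hrs hY => ?_⟩
  · exact ⟨_, ⟨(F.map_isZero (isZero_zero C)).iso hZ⟩⟩
  · exact F.essImage.prop_of_iso e hY
  · obtain ⟨X, ⟨e⟩⟩ := hY
    exact ⟨X⟦n⟧, ⟨(F.commShiftIso n).app X ≪≫ (shiftFunctor D n).mapIso e⟩⟩
  · obtain ⟨X₁, ⟨e₁⟩⟩ := h₁
    obtain ⟨X₂, ⟨e₂⟩⟩ := h₂
    obtain ⟨u, hu⟩ := F.map_surjective (e₁.hom ≫ T.mor₁ ≫ e₂.inv)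
    obtain ⟨X₃, v, w, hT'⟩ := distinguished_cocone_triangle u
    obtain ⟨e, -⟩ := exists_iso_of_arrow_iso _ _ (F.map_distinguished _ hT') hT
      (Arrow.isoMk e₁ e₂ (by
        change e₁.hom ≫ T.mor₁ = F.map u ≫ e₂.hom
        simp [hu]))
    exact ⟨X₃, ⟨Triangle.π₃.mapIso e⟩⟩
  · obtain ⟨X, ⟨e⟩⟩ := hY
    exact F.essImage_of_retract hC ((Retract.mk s r hrs).trans (Retract.ofIso e.symm))

end Functor

end CategoryTheory

theorem stmt_1 (C D : Type) [Category C] [Category D]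
    [HasZeroObject C] [HasZeroObject D] [Preadditive C] [Preadditive D]
    [HasShift C ℤ] [HasShift D ℤ]
    [∀ n : ℤ, (shiftFunctor C n).Additive] [∀ n : ℤ, (shiftFunctor D n).Additive]
    [Pretriangulated C] [Pretriangulated D] [HasFiniteBiproducts C]
    (F : C ⥤ D) [F.CommShift ℤ] [F.IsTriangulated]
    (S : Set C)
    (hS1 : ∀ X ∈ S, X⟦(1 : ℤ)⟧ ∈ S)
    (hSm1 : ∀ X ∈ S, X⟦(-1 : ℤ)⟧ ∈ S) :
    -- (1)
    ((∀ P : Set C, IsThickSubcat P → S ⊆ P → ∀ Y : C, Y ∈ P) →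
      (∀ X ∈ S, ∀ Y ∈ S, Function.Bijective
        (fun φ : X ⟶ Y => F.map φ)) →
      (F.Full ∧ F.Faithful)) ∧
    -- (2)
    (IsKrullSchmidt C →
      (∀ P : Set D, IsThickSubcat P → (∀ X : C, F.obj X ∈ P) → ∀ Y : D, Y ∈ P) →
      F.Full → F.EssSurj) := by
  refine ⟨fun hthick hbij => ?_, fun hC hthick hfull => ?_⟩
  · have hright : ∀ X ∈ S, ∀ Y : C, ∀ n : ℤ,
        Function.Bijective (fun φ : X ⟶ Y⟦n⟧ => F.map φ) := fun X hX =>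
      hthick _ (F.isThickSubcat_map_bijective_right X) (fun Y hY n => by
        obtain ⟨Y', hY', ⟨e⟩⟩ := exists_shift_iso_of_shift_one hS1 hSm1 hY n
        exact F.map_bijective_of_retract (.refl X) (.ofIso e) (hbij X hX Y' hY'))
    have hleft : ∀ Y X : C, ∀ n : ℤ,
        Function.Bijective (fun φ : X⟦n⟧ ⟶ Y => F.map φ) := fun Y =>
      hthick _ (F.isThickSubcat_map_bijective_left Y) (fun X hX n => by
        obtain ⟨X', hX', ⟨e⟩⟩ := exists_shift_iso_of_shift_one hS1 hSm1 hX n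
        exact F.map_bijective_of_retract (.ofIso e)
          (.ofIso ((shiftFunctorZero C ℤ).app Y).symm) (hright X' hX' Y 0))
    have hmap : ∀ X Y : C, Function.Bijective (fun φ : X ⟶ Y => F.map φ) := fun X Y =>
      F.map_bijective_of_retract (.ofIso ((shiftFunctorZero C ℤ).app X).symm) (.refl Y)
        (hleft Y X 0)
    exact ⟨⟨fun {X Y} => (hmap X Y).2⟩, ⟨fun {X Y} _ _ h => (hmap X Y).1 h⟩⟩
  · exact ⟨hthick _ (F.isThickSubcat_essImage hC) (fun X => F.obj_mem_essImage X)⟩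
end
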